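/- arXiv:1703.02172 — 3 statements merged into one kernel-verified Lean document; each statement's English description precedes it below -/
import Mathlib

section
/- For every integer n ≥ 2 and every integer N ≥ 3, dim_H(F_{β_n, N−1}) ≤ dim_H(E_{β_n, N}) ≤ dim_H(F_{β_n, N}). -/
open MeasureTheory Set Filter

noncomputable section

/-- `a` is a β-expansion of `x`: digits in {0,1}, with `a k` the (k+1)-st digit. -/
def IsBetaExpansion (β x : ℝ) (a : ℕ → ℕ) : Prop :=
  (∀ k, a k ≤ 1) ∧ HasSum (fun k => (a k : ℝ) / β ^ (k + 1)) x

/-- The greedy β-transformation. -/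
def greedyMap (β : ℝ) (x : ℝ) : ℝ := if x < 1 / β then β * x else β * x - 1

/-- `F_{β,N}`: points whose greedy orbit avoids `[0, β^{-N}/(β-1)]`. -/
def Fset (β : ℝ) (N : ℕ) : Set ℝ :=
  {x ∈ Icc 0 (1 / (β - 1)) |
    ∀ k : ℕ, (greedyMap β)^[k] x ∉ Icc 0 (β ^ (-(N : ℤ)) / (β - 1))}

/-- `a` contains a block of `N` consecutive zero digits. -/
def HasZeroBlock (a : ℕ → ℕ) (N : ℕ) : Prop := ∃ j : ℕ, ∀ i < N, a (j + i) = 0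

/-- `E_{β,N}`: points no β-expansion of which contains `N` consecutive zeros. -/
def Eset (β : ℝ) (N : ℕ) : Set ℝ :=
  {x ∈ Icc 0 (1 / (β - 1)) | ∀ a : ℕ → ℕ, IsBetaExpansion β x a → ¬ HasZeroBlock a N}

/-- `β` is the n-bonacci number: the root in (1,2) of `β^n = β^{n-1} + ⋯ + β + 1`. -/
def IsNBonacci (n : ℕ) (β : ℝ) : Prop :=
  β ∈ Ioo (1 : ℝ) 2 ∧ β ^ n = ∑ i ∈ Finset.range n, β ^ i

theorem hasSum_cast {f g : ℕ → ℝ} {x y : ℝ} (h : HasSum g y) (hf : ∀ k, f k = g k)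
    (hx : x = y) : HasSum f x := by
  rw [hx, funext hf]; exact h

theorem exp_tail {β x : ℝ} (h1 : 1 < β) {a : ℕ → ℕ} (h : IsBetaExpansion β x a) :
    IsBetaExpansion β (β * x - a 0) (fun k => a (k + 1)) := by
  refine ⟨fun k => h.1 _, ?_⟩
  have h2 := (hasSum_nat_add_iff' 1).2 h.2
  have h3 := h2.mul_left β
  have hb : β ≠ 0 := by positivity
  refine hasSum_cast h3 (fun k => ?_) ?_
  · show _ = _
    field_simp
    ring
  · simp
    field_simp

theorem exp_cons {β x : ℝ} (h1 : 1 < β) {a : ℕ → ℕ} {d : ℕ} (hd : d ≤ 1)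
    (h : IsBetaExpansion β (β * x - d) a) :
    IsBetaExpansion β x (fun k => Nat.casesOn k d a) := by
  have hb : β ≠ 0 := by positivity
  refine ⟨fun k => by cases k <;> simp [hd, h.1], ?_⟩
  refine (hasSum_nat_add_iff' 1).1 ?_
  have h3 := h.2.mul_left β⁻¹
  refine hasSum_cast h3 (fun k => ?_) ?_
  · show _ = _
    simp
    field_simp
    ring
  · simp
    field_simp

theorem geom_hasSum {β : ℝ} (h1 : 1 < β) :
    HasSum (fun k : ℕ => (1 : ℝ) / β ^ (k + 1)) (1 / (β - 1)) := by
  have hb : β ≠ 0 := by positivity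
  have h := (hasSum_geometric_of_lt_one (r := β⁻¹) (by positivity)
    (inv_lt_one_of_one_lt₀ h1)).mul_left β⁻¹
  have hb1 : β - 1 ≠ 0 := by linarith
  refine hasSum_cast h (fun k => ?_) ?_
  · show _ = _
    rw [one_div, ← inv_pow, pow_succ, mul_comm]
  · have : 1 - β⁻¹ ≠ 0 := by
      have := inv_lt_one_of_one_lt₀ h1
      linarith
    field_simp

theorem exp_bounds {β x : ℝ} (h1 : 1 < β) {a : ℕ → ℕ} (h : IsBetaExpansion β x a) :
    0 ≤ x ∧ x ≤ 1 / (β - 1) := by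
  have hb : 0 < β := by positivity
  refine ⟨h.2.nonneg (fun k => by positivity), hasSum_le (fun k => ?_) h.2 (geom_hasSum h1)⟩
  have : (a k : ℝ) ≤ 1 := by exact_mod_cast h.1 k
  gcongr

theorem exp_zero_bound {β : ℝ} (h1 : 1 < β) (N : ℕ) : ∀ (x : ℝ) (a : ℕ → ℕ),
    IsBetaExpansion β x a → (∀ i < N, a i = 0) → β ^ N * x ≤ 1 / (β - 1) := by
  induction N with
  | zero => intro x a h _; simpa using (exp_bounds h1 h).2
  | succ N ih =>
    intro x a h h0
    have := ih _ _ (exp_tail h1 h) (fun i hi => h0 (i + 1) (by omega))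
    rw [h0 0 (by omega)] at this
    rw [pow_succ, mul_assoc]
    simpa using this

/-- greedy digit -/
def gdig (β x : ℝ) : ℕ := if x < 1 / β then 0 else 1

theorem gdig_le (β x : ℝ) : gdig β x ≤ 1 := by unfold gdig; split_ifs <;> simp

theorem greedy_eq (β x : ℝ) : greedyMap β x = β * x - gdig β x := by
  unfold greedyMap gdig; split_ifs <;> simp

theorem greedy_mem {β x : ℝ} (h1 : 1 < β) (h2 : β < 2) (hx : x ∈ Icc 0 (1 / (β - 1))) :
    greedyMap β x ∈ Icc 0 (1 / (β - 1)) := by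
  have hb : 0 < β := by positivity
  have hb1 : 0 < β - 1 := by linarith
  obtain ⟨hx0, hx1⟩ := hx
  rw [le_div_iff₀ hb1] at hx1
  unfold greedyMap
  split_ifs with h
  · rw [lt_div_iff₀ hb] at h
    refine ⟨by positivity, ?_⟩
    rw [le_div_iff₀ hb1]
    nlinarith
  · rw [not_lt, div_le_iff₀ hb] at h
    refine ⟨by linarith, ?_⟩
    rw [le_div_iff₀ hb1]
    nlinarith

theorem greedy_iter_mem {β x : ℝ} (h1 : 1 < β) (h2 : β < 2) (hx : x ∈ Icc 0 (1 / (β - 1)))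
    (k : ℕ) : (greedyMap β)^[k] x ∈ Icc 0 (1 / (β - 1)) := by
  induction k with
  | zero => simpa using hx
  | succ k ih => rw [Function.iterate_succ_apply']; exact greedy_mem h1 h2 ih

theorem exists_exp {β x : ℝ} (h1 : 1 < β) (h2 : β < 2) (hx : x ∈ Icc 0 (1 / (β - 1))) :
    ∃ a, IsBetaExpansion β x a := by
  have hb : 0 < β := by positivity
  refine ⟨fun k => gdig β ((greedyMap β)^[k] x), fun k => gdig_le _ _, ?_⟩
  rw [hasSum_iff_tendsto_nat_of_nonneg (fun k => by positivity)]
  have hs : ∀ k : ℕ, ∑ i ∈ Finset.range k,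
      (gdig β ((greedyMap β)^[i] x) : ℝ) / β ^ (i + 1) = x - (greedyMap β)^[k] x / β ^ k := by
    intro k
    induction k with
    | zero => simp
    | succ k ih =>
      rw [Finset.sum_range_succ, ih, Function.iterate_succ_apply', greedy_eq β ((greedyMap β)^[k] x)]
      field_simp
      ring
  simp_rw [hs]
  have ht : Tendsto (fun k : ℕ => (greedyMap β)^[k] x / β ^ k) atTop (nhds 0) := by
    have hg : Tendsto (fun k : ℕ => (1 / (β - 1)) / β ^ k) atTop (nhds 0) :=
      Tendsto.div_atTop tendsto_const_nhds (tendsto_pow_atTop_atTop_of_one_lt h1)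
    refine squeeze_zero (fun k => ?_) (fun k => ?_) hg
    · exact div_nonneg (greedy_iter_mem h1 h2 hx k).1 (by positivity)
    · have := (greedy_iter_mem h1 h2 hx k).2
      gcongr
  simpa using ht.const_sub x

theorem exists_exp_zero {β : ℝ} (h1 : 1 < β) (h2 : β < 2) (N : ℕ) : ∀ x : ℝ,
    β ^ N * x ∈ Icc 0 (1 / (β - 1)) → ∃ a, IsBetaExpansion β x a ∧ ∀ i < N, a i = 0 := by
  induction N with
  | zero =>
    intro x hx
    obtain ⟨a, ha⟩ := exists_exp h1 h2 (by simpa using hx)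
    exact ⟨a, ha, by simp⟩
  | succ N ih =>
    intro x hx
    rw [pow_succ, mul_assoc] at hx
    obtain ⟨a, ha, h0⟩ := ih _ hx
    refine ⟨_, exp_cons (d := 0) h1 (by simp) (by simpa using ha), fun i hi => ?_⟩
    cases i with
    | zero => rfl
    | succ i => exact h0 i (by omega)

theorem exists_block {β : ℝ} (h1 : 1 < β) (N k : ℕ) : ∀ x : ℝ,
    (∃ a, IsBetaExpansion β ((greedyMap β)^[k] x) a ∧ HasZeroBlock a N) →
    ∃ a, IsBetaExpansion β x a ∧ HasZeroBlock a N := by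
  induction k with
  | zero => intro x h; simpa using h
  | succ k ih =>
    intro x h
    rw [Function.iterate_succ_apply] at h
    obtain ⟨a, ha, j, hj⟩ := ih _ h
    rw [greedy_eq] at ha
    refine ⟨_, exp_cons h1 (gdig_le β x) ha, j + 1, fun i hi => ?_⟩
    rw [show j + 1 + i = (j + i) + 1 by ring]
    exact hj i hi

theorem Eset_subset {β : ℝ} (h1 : 1 < β) (h2 : β < 2) (N : ℕ) : Eset β N ⊆ Fset β N := by
  rintro x ⟨hx, h⟩
  refine ⟨hx, fun k hk => ?_⟩
  have hb : 0 < β := by positivity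
  have hm : β ^ N * (greedyMap β)^[k] x ∈ Icc 0 (1 / (β - 1)) := by
    refine ⟨mul_nonneg (by positivity) hk.1, ?_⟩
    calc β ^ N * (greedyMap β)^[k] x ≤ β ^ N * (β ^ (-(N : ℤ)) / (β - 1)) := by
          have := hk.2
          gcongr
      _ = 1 / (β - 1) := by
          rw [zpow_neg, zpow_natCast]
          field_simp
  obtain ⟨a, ha, h0⟩ := exists_exp_zero h1 h2 N _ hm
  obtain ⟨b, hb, hz⟩ := exists_block h1 N k x ⟨a, ha, 0, fun i hi => by simpa using h0 i hi⟩
  exact h b hb hz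

/-- `e m = β^{-1} + ⋯ + β^{-m}` -/
def eSum (β : ℝ) (m : ℕ) : ℝ := ∑ i ∈ Finset.range m, (β⁻¹) ^ (i + 1)

theorem eSum_succ {β : ℝ} (hb : 0 < β) (m : ℕ) : β * eSum β (m + 1) = 1 + eSum β m := by
  unfold eSum
  rw [Finset.sum_range_succ', mul_add, Finset.mul_sum, add_comm]
  congr 1
  · simp; field_simp
  · refine Finset.sum_congr rfl fun i _ => ?_
    rw [pow_succ (β⁻¹) (i + 1)]
    field_simp

theorem eSum_mono {β : ℝ} (hb : 0 < β) : Monotone (eSum β) := by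
  refine monotone_nat_of_le_succ fun m => ?_
  unfold eSum
  rw [Finset.sum_range_succ]
  have : 0 < (β⁻¹) ^ (m + 1) := by positivity
  linarith

theorem eSum_n {n : ℕ} {β : ℝ} (hβ : IsNBonacci n β) : eSum β n = 1 := by
  have hb : 0 < β := by linarith [hβ.1.1]
  have h : β ^ n * eSum β n = β ^ n := by
    unfold eSum
    rw [← Finset.sum_range_reflect, Finset.mul_sum]
    conv_rhs => rw [hβ.2]
    refine Finset.sum_congr rfl fun i hi => ?_
    have hi := Finset.mem_range.1 hi
    rw [show n - 1 - i + 1 = n - i by omega, inv_pow]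
    rw [show β ^ n = β ^ i * β ^ (n - i) by rw [← pow_add]; congr 1; omega]
    field_simp
  have : β ^ n ≠ 0 := by positivity
  exact mul_left_cancel₀ this (by rw [h, mul_one])

/-- invariant for the difference between a remainder and the greedy remainder -/
def DiffInv (n : ℕ) (β d : ℝ) : Prop := (∃ m ≤ n, d = eSum β m) ∨ 1 / (β - 1) ≤ d

theorem inv_step {n : ℕ} (hn : 2 ≤ n) {β : ℝ} (hβ : IsNBonacci n β) {x y : ℝ} {c : ℕ}
    (hc : c ≤ 1) (hy : 0 ≤ β * y - c) (h : DiffInv n β (y - x)) :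
    DiffInv n β ((β * y - c) - greedyMap β x) := by
  have h1 := hβ.1.1
  have h2 := hβ.1.2
  have hb : 0 < β := by linarith
  have hb1 : 0 < β - 1 := by linarith
  have he0 : eSum β 0 = 0 := by simp [eSum]
  have he1 := eSum_succ hb 0
  have he2 := eSum_succ hb 1
  have hen := eSum_n hβ
  have hmono := eSum_mono hb
  have he2n := hmono hn
  simp only [zero_add, he0, add_zero, Nat.reduceAdd] at he1 he2
  have hgold : β + 1 ≤ β ^ 2 := by
    have h3 : β * (β * eSum β 2) = β + 1 := by rw [he2, mul_add, he1]; ring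
    rw [hen] at he2n
    nlinarith
  have h32 : 3 / 2 ≤ β := by nlinarith
  have hbig : 1 / (β - 1) ≤ 2 := by rw [div_le_iff₀ hb1]; linarith
  have hbig2 : 1 / (β - 1) ≤ 1 + eSum β 1 := by
    have : eSum β 1 = 1 / β := by field_simp; linarith
    rw [this, div_le_iff₀ hb1]
    field_simp
    nlinarith
  rw [greedy_eq]
  have hg := gdig_le β x
  have hcr : (c : ℝ) ≤ 1 := by exact_mod_cast hc
  have hgr : (0 : ℝ) ≤ gdig β x := by positivity
  rcases h with ⟨m, hm, hd⟩ | hd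
  · rcases m with _ | m
    · have hxy : y = x := by linarith
      subst hxy
      have e : β * y - c - (β * y - gdig β y) = (gdig β y : ℝ) - c := by ring
      rw [e]
      left
      unfold gdig at *
      split_ifs with hlt
      · rw [lt_div_iff₀ hb] at hlt
        have : c = 0 := by
          have : (c : ℝ) < 1 := by nlinarith
          have : c < 1 := by exact_mod_cast this
          omega
        exact ⟨0, by omega, by simp [this, he0]⟩
      · have : c = 0 ∨ c = 1 := by omega
        rcases this with rfl | rfl
        · exact ⟨n, le_rfl, by simp [hen]⟩
        · exact ⟨0, by omega, by simp [he0]⟩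
    · have e : β * y - c - (β * x - gdig β x) = 1 + eSum β m + ((gdig β x : ℝ) - c) := by
        rw [← eSum_succ hb, ← hd]; ring
      rw [e]
      have hm0 : 0 ≤ eSum β m := by rw [← he0]; exact hmono (Nat.zero_le m)
      have : c = 0 ∨ c = 1 := by omega
      have : gdig β x = 0 ∨ gdig β x = 1 := by omega
      have key : DiffInv n β (1 + eSum β m) := by
        rcases m with _ | m
        · exact Or.inl ⟨n, le_rfl, by rw [hen, he0, add_zero]⟩
        · right
          have := hmono (show 1 ≤ m + 1 by omega)
          linarith
      rcases ‹c = 0 ∨ c = 1› with hc' | hc' <;> rcases this with hg' | hg' <;> rw [hc', hg']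
      · simpa using key
      · right
        push_cast
        linarith
      · exact Or.inl ⟨m, by omega, by push_cast; ring⟩
      · simpa using key
  · right
    have : β * (1 / (β - 1)) = 1 / (β - 1) + 1 := by field_simp; ring
    nlinarith

theorem optimal {n : ℕ} (hn : 2 ≤ n) {β : ℝ} (hβ : IsNBonacci n β) (j : ℕ) :
    ∀ (x y : ℝ) (a : ℕ → ℕ), IsBetaExpansion β y a → DiffInv n β (y - x) →
    ∃ z, IsBetaExpansion β z (fun k => a (j + k)) ∧ DiffInv n β (z - (greedyMap β)^[j] x) := by
  induction j with
  | zero => intro x y a h hi; exact ⟨y, by simpa using h, by simpa using hi⟩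
  | succ j ih =>
    intro x y a h hi
    have ht := exp_tail hβ.1.1 h
    obtain ⟨z, hz, hz'⟩ := ih (greedyMap β x) _ _ ht
      (inv_step hn hβ (h.1 0) (exp_bounds hβ.1.1 ht).1 hi)
    refine ⟨z, ?_, by simpa using hz'⟩
    convert hz using 3
    ring

theorem Fset_subset {n : ℕ} (hn : 2 ≤ n) {β : ℝ} (hβ : IsNBonacci n β) (N : ℕ) :
    Fset β N ⊆ Eset β N := by
  rintro x ⟨hx, h⟩
  have h1 := hβ.1.1
  have hb : 0 < β := by linarith
  have hb1 : 0 < β - 1 := by linarith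
  refine ⟨hx, fun a ha ⟨j, hj⟩ => h j ?_⟩
  refine ⟨(greedy_iter_mem h1 hβ.1.2 hx j).1, ?_⟩
  obtain ⟨z, hz, hi⟩ := optimal hn hβ j x x a ha (Or.inl ⟨0, by omega, by simp [eSum]⟩)
  have hle : (greedyMap β)^[j] x ≤ z := by
    have : 0 ≤ z - (greedyMap β)^[j] x := by
      rcases hi with ⟨m, _, hm⟩ | hm
      · rw [hm]; unfold eSum; positivity
      · exact le_trans (by positivity) hm
    linarith
  refine hle.trans ?_
  have := exp_zero_bound h1 N z _ hz hj
  rw [zpow_neg, zpow_natCast, inv_eq_one_div, div_div, le_div_iff₀ (by positivity)]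
  rw [le_div_iff₀ hb1] at this
  linarith

theorem Fset_mono {β : ℝ} (h1 : 1 < β) {M N : ℕ} (h : M ≤ N) : Fset β M ⊆ Fset β N := by
  rintro x ⟨hx, hk⟩
  refine ⟨hx, fun k hk' => hk k ⟨hk'.1, hk'.2.trans ?_⟩⟩
  have hb1 : 0 < β - 1 := by linarith
  have : β ^ (-(N : ℤ)) ≤ β ^ (-(M : ℤ)) := zpow_le_zpow_right₀ h1.le (by omega)
  gcongr

/-- For `n ≥ 2`, `N ≥ 3`:
`dim_H F_{β_n,N-1} ≤ dim_H E_{β_n,N} ≤ dim_H F_{β_n,N}`. -/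
theorem dimH_Fset_le_dimH_Eset_le (n N : ℕ) (hn : 2 ≤ n) (hN : 3 ≤ N) (β : ℝ)
    (hβ : IsNBonacci n β) :
    dimH (Fset β (N - 1)) ≤ dimH (Eset β N) ∧ dimH (Eset β N) ≤ dimH (Fset β N) := by
  exact ⟨dimH_mono ((Fset_mono hβ.1.1 (Nat.sub_le N 1)).trans (Fset_subset hn hβ N)),
    dimH_mono (Eset_subset hβ.1.1 hβ.1.2 N)⟩
end
end

section
/- For every integer n ≥ 2, the Hausdorff dimension of E_{β_n,N} tends to 1 as N → ∞. -/
open MeasureTheory Set Filter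

noncomputable section


def tseq (n : ℕ) (e : ℕ → ℤ) (k : ℕ) : ℤ :=
  if _h : k < n then 0 else e (k - n) + ∑ i : Fin n, tseq n e (k - n + i)
termination_by k
decreasing_by omega

lemma tseq_lt (n : ℕ) (e : ℕ → ℤ) (k : ℕ) (h : k < n) : tseq n e k = 0 := by
  rw [tseq]; simp [h]

lemma tseq_add (n : ℕ) (e : ℕ → ℤ) (m : ℕ) :
    tseq n e (m + n) = e m + ∑ i ∈ Finset.range n, tseq n e (m + i) := by
  rw [tseq]; simp [Finset.sum_range]

def gco (β : ℝ) (i : ℕ) : ℝ := ∑ j ∈ Finset.range i, 1 / β ^ (j + 1)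

lemma gco_succ (β : ℝ) (hβ : 1 < β) (i : ℕ) : β * gco β (i + 1) = gco β i + 1 := by
  unfold gco
  rw [Finset.sum_range_succ', mul_add, Finset.mul_sum]
  have h0 : β ≠ 0 := by positivity
  congr 1
  · apply Finset.sum_congr rfl
    intro j _
    field_simp
    ring
  · field_simp
    ring

lemma gco_nonneg (β : ℝ) (hβ : 1 < β) (i : ℕ) : 0 ≤ gco β i := by
  unfold gco; positivity

lemma gco_mono (β : ℝ) (hβ : 1 < β) : Monotone (gco β) := by
  apply monotone_nat_of_le_succ
  intro i
  unfold gco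
  rw [Finset.sum_range_succ]
  have : 0 ≤ 1 / β ^ (i + 1) := by positivity
  linarith

lemma gco_n (n : ℕ) (β : ℝ) (hβ : IsNBonacci n β) : gco β n = 1 := by
  obtain ⟨⟨h1, h2⟩, h⟩ := hβ
  have h0 : β ≠ 0 := by positivity
  have : β ^ n * gco β n = β ^ n := by
    conv_rhs => rw [h]
    unfold gco
    rw [Finset.mul_sum, ← Finset.sum_range_reflect]
    apply Finset.sum_congr rfl
    intro j hj
    have hj := Finset.mem_range.1 hj
    have : n = (n - 1 - j + 1) + j := by omega
    nth_rewrite 1 [this]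
    rw [pow_add]
    field_simp
  have hp : β ^ n ≠ 0 := by positivity
  exact mul_left_cancel₀ hp (by rw [this, mul_one])

lemma d_eq (n : ℕ) (β : ℝ) (hβ : IsNBonacci n β) (e : ℕ → ℤ) (d : ℕ → ℝ)
    (h0 : d 0 = 0) (hd : ∀ m, d (m + 1) = β * d m + e m) (m : ℕ) :
    d m = ∑ i ∈ Finset.range n, gco β (i + 1) * (tseq n e (m + i) : ℝ) := by
  induction m with
  | zero =>
    rw [h0, Finset.sum_eq_zero]
    intro i hi
    rw [tseq_lt n e (0 + i) (by simpa using hi)]; simp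
  | succ m ih =>
    rw [hd, ih, Finset.mul_sum]
    have h1 : ∀ i, β * (gco β (i + 1) * (tseq n e (m + i) : ℝ))
        = gco β i * (tseq n e (m + i) : ℝ) + tseq n e (m + i) := by
      intro i
      rw [← mul_assoc, gco_succ β hβ.1.1]; ring
    simp_rw [h1]
    rw [Finset.sum_add_distrib]
    have h2 := Finset.sum_range_succ (fun i => gco β i * (tseq n e (m + i) : ℝ)) n
    rw [Finset.sum_range_succ', gco_n n β hβ, tseq_add] at h2
    push_cast at h2
    have h3 : gco β 0 = 0 := by simp [gco]
    rw [h3] at h2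
    have h4 : ∀ i, m + 1 + i = m + (i + 1) := by intro i; omega
    simp_rw [h4]
    linarith

lemma t_bound (n : ℕ) (hn : 2 ≤ n) (β : ℝ) (hβ : IsNBonacci n β) (e : ℕ → ℤ) (d : ℕ → ℝ) (C : ℝ)
    (h0 : d 0 = 0) (hd : ∀ m, d (m + 1) = β * d m + e m) (hC : ∀ m, |d m| ≤ C) (k : ℕ) :
    |(tseq n e k : ℝ)| ≤ 2 * C / (2 - β) := by
  obtain ⟨h1, h2⟩ := hβ.1
  have hC0 : 0 ≤ C := (abs_nonneg _).trans (hC 0)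
  set R := 2 * C / (2 - β) with hR
  have hR0 : 0 ≤ R := div_nonneg (by linarith) (by linarith)
  have hR1 : R * (2 - β) = 2 * C := by rw [hR]; field_simp [show 2 - β ≠ 0 by linarith]
  induction k using Nat.strong_induction_on with
  | _ k ih =>
    by_cases hk : k < n
    · rw [tseq_lt n e k hk]; simpa using hR0
    · obtain ⟨m, rfl⟩ : ∃ m, k = m + n := ⟨k - n, by omega⟩
      have key : (tseq n e (m + n) : ℝ) = d (m + 1) - (β - 1) * d m +
          ∑ i ∈ Finset.range n, ((β - 1) * gco β (i + 1) - gco β i) * (tseq n e (m + i) : ℝ) := by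
        rw [hd]
        have : d m = ∑ i ∈ Finset.range n, gco β (i + 1) * (tseq n e (m + i) : ℝ) :=
          d_eq n β hβ e d h0 hd m
        have h5 : ∑ i ∈ Finset.range n, ((β - 1) * gco β (i + 1) - gco β i) * (tseq n e (m + i) : ℝ)
          = ∑ i ∈ Finset.range n, ((tseq n e (m + i) : ℝ) - gco β (i + 1) * (tseq n e (m + i) : ℝ)) := by
          apply Finset.sum_congr rfl
          intro i _
          have := gco_succ β h1 i
          rw [show (β - 1) * gco β (i + 1) - gco β i = 1 - gco β (i+1) by linarith]
          ring
        rw [h5, Finset.sum_sub_distrib, ← this, tseq_add]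
        push_cast
        ring
      have h6 : |∑ i ∈ Finset.range n, ((β - 1) * gco β (i + 1) - gco β i) * (tseq n e (m + i) : ℝ)|
          ≤ ∑ i ∈ Finset.range n, ((β - 1) * gco β (i + 1) - gco β i) * R := by
        refine (Finset.abs_sum_le_sum_abs _ _).trans (Finset.sum_le_sum ?_)
        intro i hi
        have hi := Finset.mem_range.1 hi
        have hg : 0 ≤ (β - 1) * gco β (i + 1) - gco β i := by
          have := gco_succ β h1 i
          have h7 := gco_mono β h1 (show i + 1 ≤ n by omega)
          rw [gco_n n β hβ] at h7
          linarith
        rw [abs_mul, abs_of_nonneg hg]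
        exact mul_le_mul_of_nonneg_left (ih _ (by omega)) hg
      have h8 : ∑ i ∈ Finset.range n, ((β - 1) * gco β (i + 1) - gco β i) ≤ β - 1 := by
        have h9 : ∑ i ∈ Finset.range n, ((β - 1) * gco β (i + 1) - gco β i)
            = ∑ i ∈ Finset.range n, (gco β (i + 1) - gco β i) -
              (2 - β) * ∑ i ∈ Finset.range n, gco β (i + 1) := by
          rw [Finset.mul_sum, ← Finset.sum_sub_distrib]
          apply Finset.sum_congr rfl; intro i _; ring
        rw [h9, Finset.sum_range_sub, gco_n n β hβ]
        have h10 : gco β 0 = 0 := by simp [gco]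
        have h11 : 1 ≤ ∑ i ∈ Finset.range n, gco β (i + 1) := by
          have := Finset.single_le_sum (f := fun i => gco β (i + 1))
            (fun i _ => gco_nonneg β h1 (i + 1)) (Finset.mem_range.2 (show n - 1 < n by omega))
          simp only [show n - 1 + 1 = n by omega, gco_n n β hβ] at this
          exact this
        nlinarith
      rw [← Finset.sum_mul] at h6
      have h12 := hC (m + 1)
      have h13 := hC m
      rw [abs_le] at *
      constructor <;> nlinarith [mul_le_mul_of_nonneg_right h8 hR0]

lemma fin_D (n : ℕ) (hn : 2 ≤ n) (β : ℝ) (hβ : IsNBonacci n β) (C : ℝ) :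
    ∃ D : Set ℝ, D.Finite ∧ ∀ (e : ℕ → ℤ) (d : ℕ → ℝ), d 0 = 0 →
      (∀ m, d (m + 1) = β * d m + e m) → (∀ m, |d m| ≤ C) → ∀ m, d m ∈ D := by
  set R := 2 * C / (2 - β) with hR
  refine ⟨(fun v : Fin n → ℤ => ∑ i : Fin n, gco β (i + 1) * (v i : ℝ)) ''
    (Set.Icc (fun _ => -⌈R⌉) (fun _ => ⌈R⌉)), (Set.finite_Icc _ _).image _, ?_⟩
  intro e d h0 hd hC m
  refine ⟨fun i => tseq n e (m + i), ?_, ?_⟩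
  · have : ∀ k, |tseq n e k| ≤ ⌈R⌉ := by
      intro k
      have := (t_bound n hn β hβ e d C h0 hd hC k).trans (Int.le_ceil _)
      exact_mod_cast this
    exact ⟨fun i => (abs_le.1 (this _)).1, fun i => (abs_le.1 (this _)).2⟩
  · rw [d_eq n β hβ e d h0 hd m, Finset.sum_range]

lemma avoid (D : Set ℝ) (hD : D.Finite) (u v : ℝ) (huv : u < v) :
    ∃ y0 y1 ε, u ≤ y0 ∧ y0 < y1 ∧ y1 ≤ v ∧ 0 < ε ∧
      ∀ d ∈ D, ∀ y, y0 ≤ y → y ≤ y1 → 0 ≤ y + d → ε ≤ y + d := by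
  induction D, hD using Set.Finite.induction_on with
  | empty => exact ⟨u, v, 1, le_rfl, huv, le_rfl, one_pos, by simp⟩
  | @insert d D _ _ ih =>
    obtain ⟨y0, y1, ε, h1, h2, h3, h4, h5⟩ := ih
    by_cases h : -d ≤ (y0 + y1) / 2
    · refine ⟨(y0 + 3 * y1) / 4, y1, min ε ((y1 - y0) / 4), by linarith, by linarith, h3,
        lt_min h4 (by linarith), ?_⟩
      rintro d' (rfl | hd') y hy0 hy1 hy
      · exact (min_le_right _ _).trans (by linarith)
      · exact (min_le_left _ _).trans (h5 d' hd' y (by linarith) hy1 hy)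
    · refine ⟨y0, (y0 + y1) / 2, ε, h1, by linarith, by linarith, h4, ?_⟩
      rintro d' (rfl | hd') y hy0 hy1 hy
      · linarith
      · exact h5 d' hd' y hy0 (by linarith) hy

def bval (β : ℝ) (a : ℕ → ℕ) : ℝ := ∑' k, (a k : ℝ) / β ^ (k + 1)

lemma geo_hasSum (β : ℝ) (hβ : 1 < β) : HasSum (fun k : ℕ => 1 / β ^ (k + 1)) (1 / (β - 1)) := by
  have h := (hasSum_geometric_of_lt_one (r := β⁻¹) (by positivity) (inv_lt_one_of_one_lt₀ hβ)).mul_left β⁻¹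
  have e1 : (fun k : ℕ => 1 / β ^ (k + 1)) = fun k => β⁻¹ * β⁻¹ ^ k := by
    funext k; rw [pow_succ', one_div, mul_inv, inv_pow]
  have e2 : 1 / (β - 1) = β⁻¹ * (1 - β⁻¹)⁻¹ := by
    have : β ≠ 0 := by linarith
    rw [← mul_inv, mul_sub, mul_inv_cancel₀ this, mul_one, one_div]
  rw [e1, e2]
  exact h

lemma bval_summable (β : ℝ) (hβ : 1 < β) (a : ℕ → ℕ) (ha : ∀ k, a k ≤ 1) :
    Summable (fun k => (a k : ℝ) / β ^ (k + 1)) := by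
  refine Summable.of_nonneg_of_le (fun k => by positivity) (fun k => ?_) (geo_hasSum β hβ).summable
  have : (a k : ℝ) ≤ 1 := by exact_mod_cast ha k
  gcongr

lemma bval_nonneg (β : ℝ) (hβ : 1 < β) (a : ℕ → ℕ) : 0 ≤ bval β a :=
  tsum_nonneg (fun k => by positivity)

lemma bval_le (β : ℝ) (hβ : 1 < β) (a : ℕ → ℕ) (ha : ∀ k, a k ≤ 1) : bval β a ≤ 1 / (β - 1) := by
  rw [← (geo_hasSum β hβ).tsum_eq]
  refine Summable.tsum_le_tsum (fun k => ?_) (bval_summable β hβ a ha) (geo_hasSum β hβ).summable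
  have : (a k : ℝ) ≤ 1 := by exact_mod_cast ha k
  gcongr

lemma bval_split (β : ℝ) (hβ : 1 < β) (a : ℕ → ℕ) (ha : ∀ k, a k ≤ 1) (m : ℕ) :
    bval β a = ∑ j ∈ Finset.range m, (a j : ℝ) / β ^ (j + 1) + bval β (fun k => a (k + m)) / β ^ m := by
  unfold bval
  rw [← (bval_summable β hβ a ha).sum_add_tsum_nat_add m, ← tsum_div_const]
  congr 2
  funext k
  rw [div_div, ← pow_add]
  congr 2; omega

lemma bval_step (β : ℝ) (hβ : 1 < β) (a : ℕ → ℕ) (ha : ∀ k, a k ≤ 1) (m : ℕ) :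
    bval β (fun k => a (k + (m + 1))) = β * bval β (fun k => a (k + m)) - a m := by
  rw [bval_split β hβ (fun k => a (k + m)) (fun k => ha _) 1]
  have : β ≠ 0 := by linarith
  simp only [Finset.range_one, Finset.sum_singleton, zero_add, pow_one]
  rw [show (fun k => a (k + 1 + m)) = (fun k => a (k + (m + 1))) by funext k; congr 1; omega]
  field_simp
  ring

/-- words approximating a point -/
lemma word_exists (β : ℝ) (h1 : 1 < β) (h2 : β < 2) (z : ℝ) (hz0 : 0 ≤ z) (hz1 : z ≤ 1 / (β - 1)) :
    ∃ w : ℕ → ℕ, (∀ k, w k ≤ 1) ∧ ∀ P, ∑ j ∈ Finset.range P, (w j : ℝ) / β ^ (j + 1) ≤ z ∧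
      z ≤ ∑ j ∈ Finset.range P, (w j : ℝ) / β ^ (j + 1) + 1 / (β - 1) / β ^ P := by
  set C := 1 / (β - 1) with hC
  have hC1 : 1 < C := by rw [hC, lt_div_iff₀ (by linarith)]; linarith
  have hC2 : β * C = C + 1 := by
    have : β - 1 ≠ 0 := by linarith
    rw [hC]; field_simp; ring
  let dg : ℝ → ℕ := fun r => if β * r ≤ C then 0 else 1
  let r : ℕ → ℝ := fun k => Nat.rec z (fun _ r => β * r - dg r) k
  have hr0 : r 0 = z := rfl
  have hr : ∀ k, r (k + 1) = β * r k - dg (r k) := fun k => rfl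
  have hb : ∀ k, 0 ≤ r k ∧ r k ≤ C := by
    intro k
    induction k with
    | zero => exact ⟨hz0, hz1⟩
    | succ k ih =>
      rw [hr]
      by_cases h : β * r k ≤ C
      · simp only [dg, h, if_true, Nat.cast_zero, sub_zero, and_true]
        exact mul_nonneg (by linarith) ih.1
      · simp only [dg, h, if_false, Nat.cast_one]
        constructor <;> nlinarith [ih.1, ih.2]
  refine ⟨fun k => dg (r k), fun k => by simp only [dg]; split_ifs <;> omega, fun P => ?_⟩
  have key : ∑ j ∈ Finset.range P, (dg (r j) : ℝ) / β ^ (j + 1) = z - r P / β ^ P := by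
    induction P with
    | zero => simp [hr0]
    | succ P ih =>
      rw [Finset.sum_range_succ, ih, hr]
      have : β ≠ 0 := by linarith
      field_simp
      ring
  rw [key]
  have hp : 0 < β ^ P := by positivity
  have h3 : 0 ≤ r P / β ^ P := div_nonneg (hb P).1 hp.le
  have h4 : r P / β ^ P ≤ C / β ^ P := by gcongr; exact (hb P).2
  constructor <;> linarith

def blk {K : ℕ} (P : ℕ) (w : Fin K → ℕ → ℕ) (κ : ℕ → Fin K) (j : ℕ) : ℕ := w (κ (j / P)) (j % P)

lemma blk_shift {K P : ℕ} (hP : 0 < P) (w : Fin K → ℕ → ℕ) (κ : ℕ → Fin K) (q : ℕ) :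
    (fun k => blk P w κ (k + q * P)) = blk P w (fun i => κ (i + q)) := by
  funext k
  simp [blk, Nat.add_mul_div_right _ _ hP]

lemma bval_blk {K P : ℕ} (hP : 0 < P) (β : ℝ) (hβ : 1 < β) (w : Fin K → ℕ → ℕ)
    (hw : ∀ i k, w i k ≤ 1) (κ : ℕ → Fin K) :
    bval β (blk P w κ) = ∑ j ∈ Finset.range P, (w (κ 0) j : ℝ) / β ^ (j + 1) +
      bval β (blk P w (fun i => κ (i + 1))) / β ^ P := by
  rw [bval_split β hβ (blk P w κ) (fun k => hw _ _) P]
  have := blk_shift hP w κ 1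
  rw [one_mul] at this
  rw [this]
  congr 1
  apply Finset.sum_congr rfl
  intro j hj
  have hj := Finset.mem_range.1 hj
  simp [blk, Nat.div_eq_of_lt hj, Nat.mod_eq_of_lt hj]

/-- points whose block orbit lies in the good interval are in Eset -/
lemma mem_Eset (β : ℝ) (hβ : 1 < β) (D : Set ℝ)
    (hD : ∀ (e : ℕ → ℤ) (d : ℕ → ℝ), d 0 = 0 →
      (∀ m, d (m + 1) = β * d m + e m) → (∀ m, |d m| ≤ 1 / (β - 1)) → ∀ m, d m ∈ D)
    (y0 y1 ε : ℝ) (hy : ∀ d ∈ D, ∀ y, y0 ≤ y → y ≤ y1 → 0 ≤ y + d → ε ≤ y + d)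
    (a : ℕ → ℕ) (ha : ∀ k, a k ≤ 1) (P : ℕ) (hP : 0 < P)
    (hI : ∀ q, y0 ≤ bval β (fun k => a (k + q * P)) ∧ bval β (fun k => a (k + q * P)) ≤ y1)
    (M : ℕ) (hM : 1 / (β - 1) / β ^ M < ε) (N : ℕ) (hN : M + P ≤ N) :
    bval β a ∈ Eset β N := by
  refine ⟨⟨bval_nonneg β hβ a, bval_le β hβ a ha⟩, ?_⟩
  rintro b ⟨hb, hbs⟩ ⟨j, hj⟩
  have hbv : bval β b = bval β a := hbs.tsum_eq
  have key : ∀ m, bval β (fun k => b (k + m)) - bval β (fun k => a (k + m)) ∈ D := by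
    apply hD (fun m => (a m : ℤ) - b m)
    · simp [hbv]
    · intro m
      rw [bval_step β hβ a ha, bval_step β hβ b hb]
      push_cast; ring
    · intro m
      have h1 := bval_nonneg β hβ (fun k => b (k + m))
      have h2 := bval_nonneg β hβ (fun k => a (k + m))
      have h3 := bval_le β hβ (fun k => b (k + m)) (fun k => hb _)
      have h4 := bval_le β hβ (fun k => a (k + m)) (fun k => ha _)
      rw [abs_le]; constructor <;> linarith
  set q := j / P + 1 with hq
  have hq1 : j < q * P := by
    have := Nat.lt_div_mul_add hP (a := j); rw [hq, add_mul]; omega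
  have hq2 : q * P ≤ j + P := by
    have := Nat.div_mul_le_self j P; rw [hq, add_mul]; omega
  have h1 := hy _ (key (q * P)) _ (hI q).1 (hI q).2
    (by rw [add_sub_cancel]; exact bval_nonneg β hβ _)
  rw [add_sub_cancel, bval_split β hβ (fun k => b (k + q * P)) (fun k => hb _) M,
    Finset.sum_eq_zero, zero_add] at h1
  · have h2 := bval_le β hβ (fun k => b (k + M + q * P)) (fun k => hb _)
    have h3 : bval β (fun k => b (k + M + q * P)) / β ^ M ≤ 1 / (β - 1) / β ^ M := by gcongr
    linarith
  · intro i hi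
    have hi := Finset.mem_range.1 hi
    have := hj (i + q * P - j) (by omega)
    rw [show j + (i + q * P - j) = i + q * P by omega] at this
    simp [this]

/-- separation -/
lemma sep {K P : ℕ} (hP : 0 < P) (β : ℝ) (hβ : 1 < β) (w : Fin K → ℕ → ℕ)
    (hw : ∀ i k, w i k ≤ 1)
    (hs : ∀ i j : Fin K, i ≠ j → 2 * (1 / (β - 1)) / β ^ P ≤
      |∑ l ∈ Finset.range P, (w i l : ℝ) / β ^ (l + 1) - ∑ l ∈ Finset.range P, (w j l : ℝ) / β ^ (l + 1)|)
    (i : ℕ) : ∀ (κ κ' : ℕ → Fin K), (∀ l < i, κ l = κ' l) → κ i ≠ κ' i →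
    1 / (β - 1) / β ^ P * (1 / β ^ P) ^ i ≤ |bval β (blk P w κ) - bval β (blk P w κ')| := by
  have hp : 0 < β ^ P := by positivity
  induction i with
  | zero =>
    intro κ κ' _ h
    rw [bval_blk hP β hβ w hw κ, bval_blk hP β hβ w hw κ']
    have h1 := hs _ _ h
    set A := ∑ l ∈ Finset.range P, (w (κ 0) l : ℝ) / β ^ (l + 1)
    set B := ∑ l ∈ Finset.range P, (w (κ' 0) l : ℝ) / β ^ (l + 1)
    set u := bval β (blk P w fun i => κ (i + 1)) with hu
    set v := bval β (blk P w fun i => κ' (i + 1)) with hv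
    have h2 : |v / β ^ P - u / β ^ P| ≤ 1 / (β - 1) / β ^ P := by
      rw [← sub_div, abs_div, abs_of_pos hp]
      gcongr
      have h1 := bval_nonneg β hβ (blk P w fun i => κ (i + 1))
      have h2 := bval_nonneg β hβ (blk P w fun i => κ' (i + 1))
      have h3 := bval_le β hβ (blk P w fun i => κ (i + 1)) (fun k => hw _ _)
      have h4 := bval_le β hβ (blk P w fun i => κ' (i + 1)) (fun k => hw _ _)
      rw [abs_le]; constructor <;> linarith
    have h3 := abs_add_le (A + u / β ^ P - (B + v / β ^ P)) (v / β ^ P - u / β ^ P)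
    rw [show A + u / β ^ P - (B + v / β ^ P) + (v / β ^ P - u / β ^ P) = A - B by ring] at h3
    have h4 : 2 * (1 / (β - 1)) / β ^ P = 2 * (1 / (β - 1) / β ^ P) := by ring
    rw [pow_zero, mul_one]
    linarith
  | succ i ih =>
    intro κ κ' h0 h
    rw [bval_blk hP β hβ w hw κ, bval_blk hP β hβ w hw κ', h0 0 (by omega), add_sub_add_left_eq_sub,
      ← sub_div, abs_div, abs_of_pos hp]
    have := ih (fun i => κ (i + 1)) (fun i => κ' (i + 1)) (fun l hl => h0 _ (by omega)) h
    rw [pow_succ, ← mul_assoc, mul_one_div]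
    gcongr

open scoped NNReal ENNReal in
/-- dimension lower bound -/
lemma dim_lower {K : ℕ} (hK : 1 < K) (X : (ℕ → Fin K) → ℝ) (A ρ c : ℝ) (hA : 0 < A) (hρ : 0 < ρ)
    (hc : 0 < c) (hKρ : 1 / (K : ℝ) ≤ ρ ^ c)
    (hX : ∀ i (κ κ' : ℕ → Fin K), (∀ l < i, κ l = κ' l) → κ i ≠ κ' i → A * ρ ^ i ≤ |X κ - X κ'|) :
    ENNReal.ofReal c ≤ dimH (range X) := by
  have hfirst : ∀ κ κ' : ℕ → Fin K, κ ≠ κ' → ∃ i, (∀ l < i, κ l = κ' l) ∧ κ i ≠ κ' i := by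
    intro κ κ' h
    have h' : ∃ i, κ i ≠ κ' i := Function.ne_iff.1 h
    classical
    exact ⟨Nat.find h', fun l hl => not_not.1 (Nat.find_min h' hl), Nat.find_spec h'⟩
  have hinj : Function.Injective X := by
    intro κ κ' h
    by_contra hne
    obtain ⟨i, h1, h2⟩ := hfirst κ κ' hne
    have := hX i κ κ' h1 h2
    rw [h, sub_self, abs_zero] at this
    have : 0 < A * ρ ^ i := by positivity
    linarith
  have : Nonempty (ℕ → Fin K) := ⟨fun _ => ⟨0, by omega⟩⟩
  let g : ℝ → ℝ := fun x => Real.ofDigits (Function.invFun X x)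
  have hgX : ∀ κ, g (X κ) = Real.ofDigits κ := by
    intro κ; simp only [g]; rw [Function.leftInverse_invFun hinj]
  have hold : HolderOnWith (Real.toNNReal ((1 / A) ^ c)) (Real.toNNReal c) g (range X) := by
    rintro _ ⟨κ, rfl⟩ _ ⟨κ', rfl⟩
    rw [hgX, hgX]
    by_cases hne : κ = κ'
    · simp [hne]
    obtain ⟨i, h1, h2⟩ := hfirst κ κ' hne
    have h3 := hX i κ κ' h1 h2
    have h4 := Real.abs_ofDigits_sub_ofDigits_le h1
    have h5 : |Real.ofDigits κ - Real.ofDigits κ'| ≤ (1 / A) ^ c * |X κ - X κ'| ^ c := by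
      calc _ ≤ (1 / (K : ℝ)) ^ i := by rw [one_div, inv_pow]; exact h4
        _ ≤ (ρ ^ c) ^ i := by gcongr
        _ = (ρ ^ i) ^ c := by
          rw [← Real.rpow_natCast, ← Real.rpow_mul hρ.le, mul_comm, Real.rpow_mul hρ.le, Real.rpow_natCast]
        _ = (1 / A) ^ c * (A * ρ ^ i) ^ c := by
          rw [← Real.mul_rpow (by positivity) (by positivity)]
          congr 1
          field_simp
        _ ≤ _ := by gcongr
    rw [edist_dist, edist_dist, Real.dist_eq, Real.dist_eq, Real.coe_toNNReal _ hc.le,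
      ENNReal.ofReal_rpow_of_nonneg (abs_nonneg _) hc.le, ← ENNReal.ofReal, ← ENNReal.ofReal_mul (by positivity)]
    exact ENNReal.ofReal_le_ofReal h5
  have h6 := hold.dimH_image_le (Real.toNNReal_pos.2 hc)
  have h7 : Icc (0 : ℝ) 1 ⊆ g '' range X := by
    intro y hy
    obtain ⟨κ, _, hκ⟩ := Real.ofDigits_SurjOn hK hy
    exact ⟨X κ, ⟨κ, rfl⟩, by rw [hgX, hκ]⟩
  have h8 : dimH (Icc (0 : ℝ) 1) = 1 := by
    rw [Real.dimH_of_nonempty_interior (by simp)]; simp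
  have h9 : (1 : ℝ≥0∞) ≤ dimH (range X) / ENNReal.ofReal c := h8 ▸ (dimH_mono h7).trans h6
  rwa [ENNReal.le_div_iff_mul_le (by simp [hc]) (by simp), one_mul] at h9

lemma choose_P (β c δ : ℝ) (hβ : 1 < β) (hc0 : 0 < c) (hc : c < 1) (hδ : 0 < δ) :
    ∃ P K : ℕ, 0 < P ∧ 1 < K ∧ 1 / (K : ℝ) ≤ (1 / β ^ P) ^ c ∧ (K : ℝ) ≤ δ * β ^ P := by
  have hb : 1 < β ^ (1 - c) := Real.one_lt_rpow hβ (by linarith)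
  obtain ⟨P, hP⟩ := pow_unbounded_of_one_lt (2 / δ) hb
  have hle : ∀ Q, P ≤ Q → 2 / δ < (β ^ (1 - c)) ^ Q := fun Q hQ =>
    hP.trans_le (pow_le_pow_right₀ hb.le hQ)
  have hP := hle (P + 1) (by omega)
  set Q := P + 1
  have hp : 0 < β ^ Q := by positivity
  set u := (β ^ Q) ^ c with hu
  have hu1 : 1 < u := Real.one_lt_rpow (one_lt_pow₀ hβ (by omega)) hc0
  have heq : (β ^ (1 - c)) ^ Q * u = β ^ Q := by
    rw [hu, ← Real.rpow_natCast, ← Real.rpow_natCast, ← Real.rpow_mul (by linarith),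
      ← Real.rpow_mul (by linarith), ← Real.rpow_add (by linarith)]
    congr 1; ring
  refine ⟨Q, ⌈u⌉₊, by omega, Nat.lt_ceil.2 (by simpa using hu1), ?_, ?_⟩
  · rw [Real.div_rpow zero_le_one hp.le, Real.one_rpow]
    exact one_div_le_one_div_of_le (by linarith) (Nat.le_ceil _)
  · have h1 := (Nat.ceil_lt_add_one (show 0 ≤ u by linarith)).le
    rw [← heq]
    rw [div_lt_iff₀ hδ] at hP
    nlinarith

lemma lower (n : ℕ) (hn : 2 ≤ n) (β : ℝ) (hβ : IsNBonacci n β) (c : ℝ) (hc0 : 0 < c) (hc : c < 1) :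
    ∃ N0, ∀ N, N0 ≤ N → ENNReal.ofReal c ≤ dimH (Eset β N) := by
  obtain ⟨h1, h2⟩ := hβ.1
  obtain ⟨D, hDf, hD⟩ := fin_D n hn β hβ (1 / (β - 1))
  obtain ⟨y0, y1, ε, hy0, hy01, hy1, hε, hy⟩ := avoid D hDf 0 1 one_pos
  set C := 1 / (β - 1) with hC
  have hC1 : 1 < C := by rw [hC, lt_div_iff₀ (by linarith)]; linarith
  obtain ⟨P, K, hP, hK, hK1, hK2⟩ := choose_P β c ((y1 - y0) / (3 * C)) h1 hc0 hc
    (div_pos (by linarith) (by linarith))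
  have hp : 0 < β ^ P := by positivity
  have hK3 : 3 * C * K / β ^ P ≤ y1 - y0 := by
    rw [div_le_iff₀ hp]
    rw [div_mul_eq_mul_div, le_div_iff₀ (by linarith)] at hK2
    linarith
  let z : Fin K → ℝ := fun i => y0 + (C + 3 * C * (i : ℕ)) / β ^ P
  have hz : ∀ i, z i + 2 * C / β ^ P ≤ y1 := by
    intro i
    have hi : ((i : ℕ) : ℝ) + 1 ≤ K := by exact_mod_cast i.2
    have : (C + 3 * C * (i : ℕ)) / β ^ P + 2 * C / β ^ P ≤ 3 * C * K / β ^ P := by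
      rw [← add_div]; gcongr; nlinarith
    simp only [z]; linarith
  have hCp : 0 < C / β ^ P := by positivity
  have hz0 : ∀ i, y0 + C / β ^ P ≤ z i := by
    intro i
    simp only [z]
    gcongr
    have : (0 : ℝ) ≤ 3 * C * (i : ℕ) := by positivity
    linarith
  have h2C : 2 * C / β ^ P = 2 * (C / β ^ P) := by ring
  have hw : ∀ i, ∃ w : ℕ → ℕ, (∀ k, w k ≤ 1) ∧
      ∑ j ∈ Finset.range P, (w j : ℝ) / β ^ (j + 1) ≤ z i ∧
      z i ≤ ∑ j ∈ Finset.range P, (w j : ℝ) / β ^ (j + 1) + C / β ^ P := by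
    intro i
    obtain ⟨w, hw, h⟩ := word_exists β h1 h2 (z i) (by linarith [hz0 i])
      (by linarith [hz i])
    exact ⟨w, hw, h P⟩
  choose w hw1 hw2 hw3 using hw
  have hX := dim_lower hK (fun κ => bval β (blk P w κ)) (C / β ^ P) (1 / β ^ P) c hCp (by positivity)
    hc0 hK1 (by
      intro i
      apply sep hP β h1 w hw1
      have aux : ∀ i j : Fin K, i < j → 2 * C / β ^ P ≤
        ∑ l ∈ Finset.range P, (w j l : ℝ) / β ^ (l + 1) - ∑ l ∈ Finset.range P, (w i l : ℝ) / β ^ (l + 1) := by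
        intro i j hij
        have hij' : ((i : ℕ) : ℝ) + 1 ≤ (j : ℕ) := by exact_mod_cast hij
        have : z i + 3 * (C / β ^ P) ≤ z j := by
          simp only [z]
          rw [add_assoc, ← mul_div_assoc 3 C, ← add_div]
          refine add_le_add le_rfl (div_le_div_of_nonneg_right ?_ hp.le)
          nlinarith
        linarith [hw2 i, hw3 j]
      intro i j hij
      rcases lt_or_gt_of_ne hij with h | h
      · rw [abs_sub_comm]; exact (aux i j h).trans (le_abs_self _)
      · exact (aux j i h).trans (le_abs_self _))
  obtain ⟨M, hM⟩ := pow_unbounded_of_one_lt (C / ε) h1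
  refine ⟨M + P, fun N hN => hX.trans (dimH_mono ?_)⟩
  rintro _ ⟨κ, rfl⟩
  refine mem_Eset β h1 D hD y0 y1 ε hy (blk P w κ) (fun k => hw1 _ _) P hP ?_ M ?_ N hN
  · intro q
    rw [blk_shift hP, bval_blk hP β h1 w hw1]
    have h3 := bval_nonneg β h1 (blk P w fun i => κ (i + 1 + q))
    have h4 := bval_le β h1 (blk P w fun i => κ (i + 1 + q)) (fun k => hw1 _ _)
    have h5 : 0 ≤ bval β (blk P w fun i => κ (i + 1 + q)) / β ^ P := by positivity
    have h6 : bval β (blk P w fun i => κ (i + 1 + q)) / β ^ P ≤ C / β ^ P := by gcongr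
    have h7 := hz (κ (0 + q))
    have h8 := hz0 (κ (0 + q))
    have h9 := hw2 (κ (0 + q))
    have h10 := hw3 (κ (0 + q))
    constructor <;> linarith
  · rw [div_lt_iff₀ (by positivity)]
    rw [div_lt_iff₀ hε] at hM
    linarith

/-- For every integer `n ≥ 2`, `dim_H E_{β_n,N} → 1` as `N → ∞`. -/
theorem tendsto_dimH_Eset_nbonacci (n : ℕ) (hn : 2 ≤ n) (β : ℝ) (hβ : IsNBonacci n β) :
    Tendsto (fun N : ℕ => dimH (Eset β N)) atTop (nhds 1) := by
  rw [tendsto_order]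
  constructor
  · intro a ha
    have hat : a ≠ ⊤ := ne_top_of_lt ha
    have har : a.toReal < 1 := by
      have := (ENNReal.toReal_lt_toReal hat ENNReal.one_ne_top).2 ha
      simpa using this
    have h0 : 0 ≤ a.toReal := ENNReal.toReal_nonneg
    obtain ⟨N0, h⟩ := lower n hn β hβ ((a.toReal + 1) / 2) (by linarith) (by linarith)
    filter_upwards [eventually_ge_atTop N0] with N hN
    refine lt_of_lt_of_le ?_ (h N hN)
    rw [ENNReal.lt_ofReal_iff_toReal_lt hat]
    linarith
  · intro a ha
    filter_upwards with N
    exact ((dimH_mono (subset_univ _)).trans_eq Real.dimH_univ).trans_lt ha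
end
end

section
/- For every integer n ≥ 2, there exists a set S ⊆ [0, 1/(β_n−1)] of strictly positive Hausdorff dimension such that every x ∈ S has uncountably many β_n-expansions, but no β_n-expansion of x is universal. -/
open MeasureTheory Set Filter

noncomputable section

/-- `a` is a universal β-expansion of `x`. -/
def IsUniversalExpansion (β x : ℝ) (a : ℕ → ℕ) : Prop :=
  IsBetaExpansion β x a ∧
    ∀ m : ℕ, 1 ≤ m → ∀ b : Fin m → Fin 2, ∃ k₀ : ℕ, ∀ i : Fin m, a (k₀ + i) = (b i : ℕ)

/-- The value of the tail of the digit sequence starting at `k`. -/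
def tailVal (β : ℝ) (a : ℕ → ℕ) (k : ℕ) : ℝ := ∑' j, (a (k + j) : ℝ) / β ^ (j + 1)

lemma hasSum_geom_aux {β : ℝ} (hβ : 1 < β) :
    HasSum (fun j : ℕ => (1 : ℝ) / β ^ (j + 1)) (1 / (β - 1)) := by
  have h := (hasSum_geometric_of_lt_one (r := β⁻¹) (by positivity)
    (inv_lt_one_of_one_lt₀ hβ)).mul_left β⁻¹
  have h1 : β⁻¹ * (1 - β⁻¹)⁻¹ = 1 / (β - 1) := by
    have : β - 1 ≠ 0 := by linarith
    have : β ≠ 0 := by linarith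
    have h3 : 1 - β⁻¹ = (β - 1) / β := by field_simp
    rw [h3]; field_simp
  rw [h1] at h
  have e : (fun j : ℕ => (1 : ℝ) / β ^ (j + 1)) = fun i => β⁻¹ * β⁻¹ ^ i := by
    ext j
    rw [pow_succ, one_div, mul_inv, inv_pow, mul_comm]
  rw [e]
  exact h

lemma tail_summable {β : ℝ} (hβ : 1 < β) {a : ℕ → ℕ} (ha : ∀ k, a k ≤ 1) (k : ℕ) :
    Summable (fun j => (a (k + j) : ℝ) / β ^ (j + 1)) := by
  refine Summable.of_nonneg_of_le (fun j => by positivity) (fun j => ?_)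
    (hasSum_geom_aux hβ).summable
  have : (a (k + j) : ℝ) ≤ 1 := by exact_mod_cast ha _
  gcongr

lemma tail_nonneg {β : ℝ} (hβ : 1 < β) (a : ℕ → ℕ) (k : ℕ) : 0 ≤ tailVal β a k :=
  tsum_nonneg (fun j => by positivity)

lemma tail_le {β : ℝ} (hβ : 1 < β) {a : ℕ → ℕ} (ha : ∀ k, a k ≤ 1) (k : ℕ) :
    tailVal β a k ≤ 1 / (β - 1) := by
  rw [← (hasSum_geom_aux hβ).tsum_eq]
  refine (tail_summable hβ ha k).tsum_le_tsum (fun j => ?_) (hasSum_geom_aux hβ).summable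
  have : (a (k + j) : ℝ) ≤ 1 := by exact_mod_cast ha _
  gcongr

lemma tail_split {β : ℝ} (hβ : 1 < β) {a : ℕ → ℕ} (ha : ∀ k, a k ≤ 1) (k m : ℕ) :
    tailVal β a k = ∑ i ∈ Finset.range m, (a (k + i) : ℝ) / β ^ (i + 1)
      + tailVal β a (k + m) / β ^ m := by
  unfold tailVal
  rw [← (tail_summable hβ ha k).sum_add_tsum_nat_add m]
  congr 1
  rw [← tsum_div_const]
  congr 1
  ext j
  rw [div_div, ← pow_add, show k + m + j = k + (j + m) by ring,
    show j + 1 + m = j + m + 1 by ring]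

lemma tail_step {β : ℝ} (hβ : 1 < β) {a : ℕ → ℕ} (ha : ∀ k, a k ≤ 1) (k : ℕ) :
    tailVal β a (k + 1) = β * tailVal β a k - a k := by
  have := tail_split hβ ha k 1
  have h0 : β ≠ 0 := by linarith
  simp at this
  rw [this]; field_simp; ring

lemma tail_zero_eq {β x : ℝ} {a : ℕ → ℕ} (h : IsBetaExpansion β x a) : tailVal β a 0 = x := by
  unfold tailVal
  simpa using h.2.tsum_eq

lemma isExp_tail {β : ℝ} (hβ : 1 < β) {a : ℕ → ℕ} (ha : ∀ k, a k ≤ 1) :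
    IsBetaExpansion β (tailVal β a 0) a := by
  refine ⟨ha, ?_⟩
  have := (tail_summable hβ ha 0).hasSum
  unfold tailVal
  simpa using this

lemma nb_sq {n : ℕ} (hn : 2 ≤ n) {β : ℝ} (hβ : IsNBonacci n β) : β + 1 ≤ β ^ 2 := by
  obtain ⟨⟨h1, h2⟩, h⟩ := hβ
  obtain ⟨m, rfl⟩ := Nat.exists_eq_add_of_le' hn
  rw [Finset.sum_range_succ, Finset.sum_range_succ] at h
  have h3 : 0 ≤ ∑ i ∈ Finset.range m, β ^ i := Finset.sum_nonneg (fun i _ => by positivity)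
  have h4 : 0 < β ^ m := by positivity
  have : β ^ m * (β + 1) ≤ β ^ m * β ^ 2 := by
    have e1 : β ^ (m + 2) = β ^ m * β ^ 2 := by ring
    have e2 : β ^ (m + 1) = β ^ m * β := by ring
    rw [e1, e2] at h
    linarith
  exact le_of_mul_le_mul_left this h4

/-- Carry states. -/
def carry (β : ℝ) : ℕ → ℝ
  | 0 => 1
  | j + 1 => β * carry β j - 1

lemma carry_eq (β : ℝ) (j : ℕ) : carry β j = β ^ j - ∑ i ∈ Finset.range j, β ^ i := by
  induction j with
  | zero => simp [carry]
  | succ j ih =>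
    rw [carry, ih, Finset.sum_range_succ', mul_sub, Finset.mul_sum]
    simp only [pow_succ', pow_zero]
    ring

lemma carry_n {n : ℕ} {β : ℝ} (hβ : IsNBonacci n β) : carry β n = 0 := by
  rw [carry_eq, hβ.2, sub_self]

lemma carry_nonneg {n : ℕ} {β : ℝ} (hβ : IsNBonacci n β) (i : ℕ) :
    ∀ j, j + i = n → 0 ≤ carry β j := by
  induction i with
  | zero => intro j hj; rw [show j = n by omega, carry_n hβ]
  | succ i ih =>
    intro j hj
    have := ih (j + 1) (by omega)
    rw [carry] at this
    have h1 := hβ.1.1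
    by_contra hc
    push Not at hc
    nlinarith

lemma carry_pos {n : ℕ} {β : ℝ} (hβ : IsNBonacci n β) {j : ℕ} (hj : j < n) :
    1 ≤ β * carry β j := by
  have := carry_nonneg hβ (n - (j + 1)) (j + 1) (by omega)
  rw [carry] at this
  linarith

lemma carry_closed {n : ℕ} (hn : 2 ≤ n) {β : ℝ} (hβ : IsNBonacci n β) {a b : ℕ → ℕ}
    (ha : ∀ k, a k ≤ 1) (hb : ∀ k, b k ≤ 1)
    (hpos : ∀ k, 0 < tailVal β a k) (hlt : ∀ k, tailVal β a k < 1)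
    (h0 : tailVal β a 0 = tailVal β b 0) (k : ℕ) :
    ∃ j ≤ n, tailVal β b k - tailVal β a k = carry β j := by
  have h1 := hβ.1.1
  have h2 := hβ.1.2
  have hsq := nb_sq hn hβ
  have hb1 : (3 : ℝ) / 2 < β := by nlinarith
  have hM : (1 / (β - 1)) * (β - 1) = 1 := by
    have : β - 1 ≠ 0 := by linarith
    field_simp
  induction k with
  | zero => exact ⟨n, le_rfl, by rw [carry_n hβ, h0, sub_self]⟩
  | succ k ih =>
    obtain ⟨j, hj, he⟩ := ih
    have sa := tail_step h1 ha k
    have sb := tail_step h1 hb k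
    have hd : tailVal β b (k + 1) - tailVal β a (k + 1) = β * carry β j + a k - b k := by
      rw [← he, sa, sb]; ring
    have p1 := hpos (k + 1)
    have p2 := hlt (k + 1)
    have q1 := tail_nonneg h1 b (k + 1)
    have q2 := tail_le h1 hb (k + 1)
    have hM2 : 1 / (β - 1) < 2 := by
      rw [div_lt_iff₀ (by linarith)]; linarith
    rw [hd]
    rcases hj.lt_or_eq with hj | rfl
    · have hc := carry_pos hβ hj
      have hcn := carry_nonneg hβ (n - (j + 1)) (j + 1) (by omega)
      have hcs : carry β (j + 1) = β * carry β j - 1 := rfl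
      have ka := ha k
      have kb := hb k
      have hab : a k = b k → ∃ i ≤ n, β * carry β j + a k - b k = carry β i := by
        intro hab
        by_cases hjn : j + 1 = n
        · refine ⟨0, by omega, ?_⟩
          have : carry β (j + 1) = 0 := by rw [hjn]; exact carry_n hβ
          rw [hab, show carry β 0 = 1 from rfl]
          linarith
        · exfalso
          have hc2 := carry_pos hβ (show j + 1 < n by omega)
          rw [hab] at hd
          have h5 : β * carry β j < 1 / (β - 1) := by linarith
          have h6 : β * (β * carry β j) < β * (1 / (β - 1)) := by gcongr
          have h7 : β + 1 ≤ β * (β * carry β j) := by rw [hcs] at hc2; nlinarith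
          have h8 : β * (1 / (β - 1)) = 1 / (β - 1) + 1 := by linarith
          have h9 : 1 / (β - 1) ≤ β := by
            rw [div_le_iff₀ (by linarith)]; nlinarith
          linarith
      interval_cases h : a k <;> interval_cases h' : b k
      · exact hab rfl
      · exact ⟨j + 1, hj, by rw [hcs]; push_cast; ring⟩
      · exfalso
        push_cast at hd
        linarith
      · exact hab rfl
    · have hz := carry_n hβ
      rw [hz] at hd ⊢
      have ka := ha k
      have kb := hb k
      interval_cases h : a k <;> interval_cases h' : b k
      · exact ⟨j, le_rfl, by rw [hz]; simp⟩
      · exfalso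
        push_cast at hd
        linarith
      · exact ⟨0, by omega, by simp [carry]⟩
      · exact ⟨j, le_rfl, by rw [hz]; simp⟩

lemma not_universal {n : ℕ} (hn : 2 ≤ n) {β : ℝ} (hβ : IsNBonacci n β) {a : ℕ → ℕ}
    (ha : ∀ k, a k ≤ 1) {c : ℝ} (hc : 0 < c)
    (hpos : ∀ k, c ≤ tailVal β a k) (hlt : ∀ k, tailVal β a k < 1) (b : ℕ → ℕ) :
    ¬ IsUniversalExpansion β (tailVal β a 0) b := by
  rintro ⟨he, hu⟩
  have h1 := hβ.1.1
  have hM : 0 < 1 / (β - 1) := by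
    have : 0 < β - 1 := by linarith
    positivity
  obtain ⟨m, hm⟩ := pow_unbounded_of_one_lt ((1 / (β - 1)) / c) h1
  obtain ⟨k, hk⟩ := hu (m + 1) (by omega) (fun _ => 0)
  obtain ⟨j, hj, hd⟩ := carry_closed hn hβ ha he.1 (fun k => hc.trans_le (hpos k)) hlt
    (tail_zero_eq he).symm k
  have hcn := carry_nonneg hβ (n - j) j (by omega)
  have hs := tail_split h1 he.1 k m
  rw [Finset.sum_eq_zero, zero_add] at hs
  · have h3 := tail_le h1 he.1 (k + m)
    have h4 := hpos k
    have hp : 0 < β ^ m := by positivity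
    have h5 : c ≤ tailVal β b (k + m) / β ^ m := by linarith
    rw [le_div_iff₀ hp] at h5
    rw [div_lt_iff₀ hc] at hm
    linarith
  · intro i hi
    have := hk ⟨i, by have := Finset.mem_range.1 hi; omega⟩
    simp at this
    simp [this]

/-- Block digits: in block `j` (of length `n+2`) either `1 0^n` (if `τ j = false`)
or `0 1^n` (if `τ j = true`) starting at position `ω j`. -/
def dg (n : ℕ) (ω : ℕ → Fin 2) (τ : ℕ → Bool) (k : ℕ) : ℕ :=
  if τ (k / (n + 2)) then
    (if (ω (k / (n + 2)) : ℕ) < k % (n + 2) ∧ k % (n + 2) ≤ (ω (k / (n + 2)) : ℕ) + n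
      then 1 else 0)
  else (if k % (n + 2) = (ω (k / (n + 2)) : ℕ) then 1 else 0)

lemma dg_le (n : ℕ) (ω : ℕ → Fin 2) (τ : ℕ → Bool) (k : ℕ) : dg n ω τ k ≤ 1 := by
  unfold dg; split_ifs <;> simp

lemma dg_block (n : ℕ) (ω : ℕ → Fin 2) (τ : ℕ → Bool) (j i : ℕ) (hi : i < n + 2) :
    dg n ω τ ((n + 2) * j + i) = if τ j then (if (ω j : ℕ) < i ∧ i ≤ (ω j : ℕ) + n then 1 else 0)
      else (if i = (ω j : ℕ) then 1 else 0) := by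
  have h1 : ((n + 2) * j + i) / (n + 2) = j := by
    rw [Nat.mul_add_div (by omega), Nat.div_eq_of_lt hi, add_zero]
  have h2 : ((n + 2) * j + i) % (n + 2) = i := by
    rw [Nat.mul_add_mod, Nat.mod_eq_of_lt hi]
  unfold dg
  rw [h1, h2]

/-- The base sequence. -/
def bs (n : ℕ) (ω : ℕ → Fin 2) : ℕ → ℕ := dg n ω (fun _ => false)

lemma bs_le (n : ℕ) (ω : ℕ → Fin 2) (k : ℕ) : bs n ω k ≤ 1 := dg_le _ _ _ _

lemma bs_block (n : ℕ) (ω : ℕ → Fin 2) (j i : ℕ) (hi : i < n + 2) :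
    bs n ω ((n + 2) * j + i) = if i = (ω j : ℕ) then 1 else 0 := by
  unfold bs; rw [dg_block _ _ _ _ _ hi]; simp

lemma geom_block {n : ℕ} {β : ℝ} (hβ : IsNBonacci n β) (p : ℕ) :
    ∑ i ∈ Finset.Icc (p + 1) (p + n), (1 : ℝ) / β ^ (i + 1) = 1 / β ^ (p + 1) := by
  have h1 := hβ.1.1
  have hb : β ≠ 0 := by linarith
  have e : Finset.Icc (p + 1) (p + n) = Finset.Ico (p + 1) (p + n + 1) := by
    ext; simp
  rw [e, Finset.sum_Ico_eq_sum_range, show p + n + 1 - (p + 1) = n by omega,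
    ← Finset.sum_range_reflect]
  have : ∀ i ∈ Finset.range n, (1 : ℝ) / β ^ (p + 1 + (n - 1 - i) + 1)
      = β ^ i / β ^ (p + 1 + n) := by
    intro i hi
    have := Finset.mem_range.1 hi
    rw [div_eq_div_iff (by positivity) (by positivity), ← pow_add, one_mul]
    congr 1; omega
  rw [Finset.sum_congr rfl this, ← Finset.sum_div, ← hβ.2, pow_add]
  field_simp

lemma block_sum {n : ℕ} {β : ℝ} (hβ : IsNBonacci n β) (ω : ℕ → Fin 2)
    (τ : ℕ → Bool) (j : ℕ) :
    ∑ i ∈ Finset.range (n + 2), (dg n ω τ ((n + 2) * j + i) : ℝ) / β ^ (i + 1)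
      = 1 / β ^ ((ω j : ℕ) + 1) := by
  have hw := (ω j).2
  rw [Finset.sum_congr rfl (fun i hi => by rw [dg_block _ _ _ _ _ (Finset.mem_range.1 hi)])]
  by_cases ht : τ j
  · rw [← geom_block hβ]
    simp only [ht, if_true, Nat.cast_ite, ite_div, Nat.cast_one, Nat.cast_zero, zero_div]
    rw [← Finset.sum_filter]
    congr 1
    ext i; simp; omega
  · simp only [ht, Nat.cast_ite, ite_div, Nat.cast_one, Nat.cast_zero, zero_div]
    simp
    omega

lemma dg_tail_diff {n : ℕ} {β : ℝ} (hβ : IsNBonacci n β) (ω : ℕ → Fin 2) (τ : ℕ → Bool) :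
    tailVal β (dg n ω τ) 0 = tailVal β (bs n ω) 0 := by
  have h1 := hβ.1.1
  have key : ∀ j, tailVal β (dg n ω τ) 0 - tailVal β (bs n ω) 0 =
      (tailVal β (dg n ω τ) ((n + 2) * j) - tailVal β (bs n ω) ((n + 2) * j))
        / (β ^ (n + 2)) ^ j := by
    intro j
    induction j with
    | zero => simp
    | succ j ih =>
      rw [ih, tail_split h1 (dg_le n ω τ) ((n + 2) * j) (n + 2),
        tail_split h1 (bs_le n ω) ((n + 2) * j) (n + 2), block_sum hβ]
      unfold bs
      rw [block_sum hβ, mul_add, mul_one, pow_succ]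
      have : β ≠ 0 := by linarith
      field_simp
      ring
  have hR : 1 < β ^ (n + 2) := one_lt_pow₀ h1 (by omega)
  by_contra hne
  have hpos : 0 < |tailVal β (dg n ω τ) 0 - tailVal β (bs n ω) 0| :=
    abs_pos.2 (sub_ne_zero.2 hne)
  obtain ⟨m, hm⟩ := pow_unbounded_of_one_lt
    ((1 / (β - 1)) / |tailVal β (dg n ω τ) 0 - tailVal β (bs n ω) 0|) hR
  rw [div_lt_iff₀ hpos, key m, abs_div, abs_of_pos (show 0 < (β ^ (n + 2)) ^ m by positivity),
    mul_div_cancel₀ _ (by positivity)] at hm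
  have a1 := tail_le h1 (dg_le n ω τ) ((n + 2) * m)
  have a2 := tail_le h1 (bs_le n ω) ((n + 2) * m)
  have a3 := tail_nonneg h1 (dg n ω τ) ((n + 2) * m)
  have a4 := tail_nonneg h1 (bs n ω) ((n + 2) * m)
  have := abs_le.2 ⟨show -(1 / (β - 1)) ≤ tailVal β (dg n ω τ) ((n + 2) * m) -
    tailVal β (bs n ω) ((n + 2) * m) by linarith, show tailVal β (dg n ω τ) ((n + 2) * m) -
    tailVal β (bs n ω) ((n + 2) * m) ≤ 1 / (β - 1) by linarith⟩
  linarith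

lemma dg_injective {n : ℕ} (ω : ℕ → Fin 2) : Function.Injective (dg n ω) := by
  intro τ τ' h
  ext1 j
  have hw := (ω j).2
  have h1 := congrFun h ((n + 2) * j + (ω j : ℕ))
  rw [dg_block _ _ _ _ _ (by omega), dg_block _ _ _ _ _ (by omega)] at h1
  cases h2 : τ j <;> cases h3 : τ' j <;> simp [h2, h3] at h1 ⊢

lemma uncountable_exp {n : ℕ} {β : ℝ} (hβ : IsNBonacci n β) (ω : ℕ → Fin 2) :
    ¬ ({a : ℕ → ℕ | IsBetaExpansion β (tailVal β (bs n ω) 0) a}).Countable := by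
  intro hc
  have h1 := hβ.1.1
  have hr : (range (dg n ω)).Countable := by
    refine hc.mono ?_
    rintro _ ⟨τ, rfl⟩
    rw [mem_ofPred_eq, ← dg_tail_diff hβ ω τ]
    exact isExp_tail h1 (dg_le n ω τ)
  have hu : (univ : Set (ℕ → Bool)).Countable := by
    have := hr.preimage_of_injOn (f := dg n ω) (dg_injective ω).injOn
    refine Countable.mono (fun τ _ => ?_) this
    exact mem_preimage.2 (mem_range_self τ)
  have h2 : Cardinal.mk (ℕ → Bool) = 2 ^ Cardinal.aleph0 := by
    rw [Cardinal.mk_arrow]; simp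
  have := Cardinal.mk_le_aleph0_iff.2 (countable_univ_iff.1 hu)
  rw [h2] at this
  exact absurd this (not_le.2 (Cardinal.cantor _))

lemma bs_one {n : ℕ} (hn : 2 ≤ n) (ω : ℕ → Fin 2) {k : ℕ} (h : bs n ω k = 1) :
    bs n ω (k + 1) = 0 ∧ bs n ω (k + 2) = 0 := by
  have hk := Nat.div_add_mod k (n + 2)
  have hlt := Nat.mod_lt k (show 0 < n + 2 by omega)
  have hw := (ω (k / (n + 2))).2
  set j := k / (n + 2)
  set i := k % (n + 2)
  rw [← hk, bs_block _ _ _ _ hlt] at h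
  have hi : i = (ω j : ℕ) := by
    by_contra hne; simp [hne] at h
  rw [← hk, add_assoc, add_assoc, bs_block _ _ _ _ (by omega), bs_block _ _ _ _ (by omega)]
  constructor <;> rw [if_neg (by omega)]

lemma bs_tail_lt {n : ℕ} (hn : 2 ≤ n) {β : ℝ} (hβ : IsNBonacci n β) (ω : ℕ → Fin 2) (k : ℕ) :
    tailVal β (bs n ω) k < 1 := by
  have h1 := hβ.1.1
  have hsq := nb_sq hn hβ
  have h3 : β ^ 2 + 1 < β ^ 3 := by nlinarith
  have hb0 : 0 < β := by linarith
  have step : ∀ k, tailVal β (bs n ω) k ≤ 1 / β + tailVal β (bs n ω) (k + 3) / β ^ 3 := by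
    intro k
    rw [tail_split h1 (bs_le n ω) k 3]
    gcongr
    have e1 : 1 / β ^ 2 ≤ 1 / β := one_div_le_one_div_of_le hb0 (by nlinarith)
    have e2 : 1 / β ^ 3 ≤ 1 / β := one_div_le_one_div_of_le hb0 (by nlinarith)
    have e0 : 0 ≤ 1 / β := by positivity
    simp only [Finset.sum_range_succ, Finset.sum_range_zero, add_zero, zero_add, pow_one]
    have c0 := bs_le n ω k
    have c1 := bs_le n ω (k + 1)
    have c2 := bs_le n ω (k + 2)
    by_cases d0 : bs n ω k = 1
    · obtain ⟨f1, f2⟩ := bs_one hn ω d0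
      rw [d0, f1, f2]; simp
    · have d0' : bs n ω k = 0 := by omega
      by_cases d1 : bs n ω (k + 1) = 1
      · obtain ⟨f1, f2⟩ := bs_one hn ω d1
        rw [d0', d1, f1]; simpa using e1
      · have d1' : bs n ω (k + 1) = 0 := by omega
        rw [d0', d1']
        interval_cases h : bs n ω (k + 2)
        · simpa using e0
        · simpa using e2
  have hbdd : BddAbove (range (tailVal β (bs n ω))) :=
    ⟨1 / (β - 1), by rintro _ ⟨k, rfl⟩; exact tail_le h1 (bs_le n ω) k⟩
  have hM : (⨆ k, tailVal β (bs n ω) k) ≤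
      1 / β + (⨆ k, tailVal β (bs n ω) k) / β ^ 3 := by
    refine ciSup_le (fun k => (step k).trans ?_)
    gcongr
    exact le_ciSup hbdd (k + 3)
  have hk := le_ciSup hbdd k
  set M := ⨆ k, tailVal β (bs n ω) k
  refine hk.trans_lt ?_
  by_contra hc
  push Not at hc
  have e : 1 / β + M / β ^ 3 = (β ^ 2 + M) / β ^ 3 := by field_simp
  rw [e, le_div_iff₀ (by positivity)] at hM
  nlinarith

lemma bs_tail_ge {n : ℕ} {β : ℝ} (hβ : IsNBonacci n β) (ω : ℕ → Fin 2)
    (k : ℕ) : 1 / β ^ (2 * (n + 2)) ≤ tailVal β (bs n ω) k := by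
  have h1 := hβ.1.1
  have hb0 : 0 < β := by linarith
  have hk := Nat.div_add_mod k (n + 2)
  have hlt := Nat.mod_lt k (show 0 < n + 2 by omega)
  set j := k / (n + 2)
  set i := k % (n + 2)
  have hw := (ω (j + 1)).2
  have hd : bs n ω (k + (n + 2 - i + (ω (j + 1) : ℕ))) = 1 := by
    have : k + (n + 2 - i + (ω (j + 1) : ℕ)) = (n + 2) * (j + 1) + (ω (j + 1) : ℕ) := by
      rw [← hk, mul_add]; omega
    rw [this, bs_block _ _ _ _ (by omega), if_pos rfl]
  have h2 := (tail_summable h1 (bs_le n ω) k).le_tsum (n + 2 - i + (ω (j + 1) : ℕ))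
    (fun j _ => by positivity)
  rw [hd] at h2
  refine le_trans ?_ h2
  rw [Nat.cast_one]
  apply one_div_le_one_div_of_le (by positivity)
  exact pow_le_pow_right₀ h1.le (by omega)

/-- Separation constant. -/
def sepC (β : ℝ) : ℝ := 1 / β - 1 / β ^ 2 - 1 / β ^ 4

lemma sepC_pos {n : ℕ} (hn : 2 ≤ n) {β : ℝ} (hβ : IsNBonacci n β) : 0 < sepC β := by
  have h1 := hβ.1.1
  have hsq := nb_sq hn hβ
  have h3 : β ^ 2 + 1 < β ^ 3 := by nlinarith
  have hb0 : 0 < β := by linarith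
  have : sepC β = (β ^ 3 - β ^ 2 - 1) / β ^ 4 := by
    unfold sepC; field_simp
  rw [this]
  apply div_pos <;> [linarith; positivity]

lemma sep_aux {n : ℕ} (hn : 2 ≤ n) {β : ℝ} (hβ : IsNBonacci n β) {ω ω' : ℕ → Fin 2} {N : ℕ}
    (h0 : ω N = 0) (h1' : ω' N = 1) :
    sepC β ≤ tailVal β (bs n ω) ((n + 2) * N) - tailVal β (bs n ω') ((n + 2) * N) := by
  have h1 := hβ.1.1
  have hb0 : 0 < β := by linarith
  have hl : 1 / β ≤ tailVal β (bs n ω) ((n + 2) * N) := by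
    rw [tail_split h1 (bs_le n ω) _ 1]
    have := tail_nonneg h1 (bs n ω) ((n + 2) * N + 1)
    simp only [Finset.sum_range_succ, Finset.sum_range_zero, zero_add, pow_one]
    rw [bs_block _ _ _ _ (by omega), h0]
    simp
    positivity
  have hu : tailVal β (bs n ω') ((n + 2) * N) ≤ 1 / β ^ 2 + 1 / β ^ 4 := by
    rw [tail_split h1 (bs_le n ω') _ 4]
    have := (bs_tail_lt hn hβ ω' ((n + 2) * N + 4)).le
    gcongr
    simp only [Finset.sum_range_succ, Finset.sum_range_zero, zero_add, pow_one]
    rw [bs_block _ _ _ _ (by omega), bs_block _ _ _ _ (by omega), bs_block _ _ _ _ (by omega),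
      bs_block _ _ _ _ (by omega), h1']
    simp
  unfold sepC
  linarith

lemma sep_s7 {n : ℕ} (hn : 2 ≤ n) {β : ℝ} (hβ : IsNBonacci n β) {ω ω' : ℕ → Fin 2} {N : ℕ}
    (hag : ∀ i < N, ω i = ω' i) (hne : ω N ≠ ω' N) :
    sepC β / (β ^ (n + 2)) ^ N ≤ |tailVal β (bs n ω) 0 - tailVal β (bs n ω') 0| := by
  have h1 := hβ.1.1
  have hb0 : 0 < β := by linarith
  have e : tailVal β (bs n ω) 0 - tailVal β (bs n ω') 0 = (tailVal β (bs n ω) ((n + 2) * N) -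
      tailVal β (bs n ω') ((n + 2) * N)) / (β ^ (n + 2)) ^ N := by
    rw [tail_split h1 (bs_le n ω) 0 ((n + 2) * N), tail_split h1 (bs_le n ω') 0 ((n + 2) * N)]
    have : ∀ i ∈ Finset.range ((n + 2) * N), (bs n ω (0 + i) : ℝ) / β ^ (i + 1) =
        (bs n ω' (0 + i) : ℝ) / β ^ (i + 1) := by
      intro i hi
      have hi' : i / (n + 2) < N := Nat.div_lt_of_lt_mul (Finset.mem_range.1 hi)
      simp [bs, dg, hag _ hi']
    rw [Finset.sum_congr rfl this, pow_mul]
    simp only [zero_add]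
    ring
  rw [e, abs_div, abs_of_pos (show 0 < (β ^ (n + 2)) ^ N by positivity)]
  gcongr
  have c : (ω N = 0 ∧ ω' N = 1) ∨ (ω N = 1 ∧ ω' N = 0) := by omega
  rcases c with ⟨c1, c2⟩ | ⟨c1, c2⟩
  · exact (sep_aux hn hβ c1 c2).trans (le_abs_self _)
  · rw [abs_sub_comm]
    exact (sep_aux hn hβ c2 c1).trans (le_abs_self _)

lemma holder_bound {n : ℕ} (hn : 2 ≤ n) {β : ℝ} (hβ : IsNBonacci n β) {s : ℝ} (hs : 0 < s)
    (hR : (β ^ (n + 2)) ^ s = 2) (ω ω' : ℕ → Fin 2) :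
    |Real.ofDigits ω - Real.ofDigits ω'| ≤
      (sepC β ^ s)⁻¹ * |tailVal β (bs n ω) 0 - tailVal β (bs n ω') 0| ^ s := by
  have h1 := hβ.1.1
  have hb0 : 0 < β := by linarith
  have hsep := sepC_pos hn hβ
  by_cases h : ω = ω'
  · subst h
    simp
    positivity
  · have hex : ∃ N, ω N ≠ ω' N := by
      by_contra hc; push Not at hc; exact h (funext hc)
    classical
    have hN := Nat.find_spec hex
    have hag : ∀ i < Nat.find hex, ω i = ω' i := fun i hi => by
      simpa using Nat.find_min hex hi
    set N := Nat.find hex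
    have k1 := Real.abs_ofDigits_sub_ofDigits_le (n := N) hag
    have k2 := Real.rpow_le_rpow (by positivity) (sep_s7 hn hβ hag hN) hs.le
    rw [Real.div_rpow hsep.le (by positivity), ← Real.rpow_natCast (β ^ (n + 2)) N,
      ← Real.rpow_mul (by positivity), mul_comm (N : ℝ) s, Real.rpow_mul (by positivity), hR,
      Real.rpow_natCast] at k2
    have hp : 0 < sepC β ^ s := by positivity
    rw [inv_mul_eq_div, le_div_iff₀ hp]
    refine le_trans ?_ k2
    rw [div_eq_mul_inv, mul_comm]
    gcongr
    simpa using k1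

lemma dim_pos {n : ℕ} (hn : 2 ≤ n) {β : ℝ} (hβ : IsNBonacci n β) :
    0 < dimH (range (fun ω : ℕ → Fin 2 => tailVal β (bs n ω) 0)) := by
  have h1 := hβ.1.1
  have hb0 : 0 < β := by linarith
  have hR1 : 1 < β ^ (n + 2) := one_lt_pow₀ h1 (by omega)
  have hsep := sepC_pos hn hβ
  set s : ℝ := Real.log 2 / Real.log (β ^ (n + 2)) with hs_def
  have hlog := Real.log_pos hR1
  have hs : 0 < s := div_pos (Real.log_pos (by norm_num)) hlog
  have hR : (β ^ (n + 2)) ^ s = 2 := by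
    rw [Real.rpow_def_of_pos (by positivity), hs_def, mul_div_cancel₀ _ hlog.ne',
      Real.exp_log (by norm_num)]
  have hb := holder_bound hn hβ hs hR
  set X : (ℕ → Fin 2) → ℝ := fun ω => tailVal β (bs n ω) 0 with hX
  set C : ℝ := (sepC β ^ s)⁻¹ with hC
  have hC0 : 0 ≤ C := by positivity
  let f : ℝ → ℝ := fun x => Real.ofDigits (Function.invFun X x)
  have hf : HolderOnWith C.toNNReal s.toNNReal f (range X) := by
    rintro x ⟨ω, rfl⟩ y ⟨ω', rfl⟩
    have e1 : X (Function.invFun X (X ω)) = X ω := Function.invFun_eq ⟨ω, rfl⟩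
    have e2 : X (Function.invFun X (X ω')) = X ω' := Function.invFun_eq ⟨ω', rfl⟩
    have := hb (Function.invFun X (X ω)) (Function.invFun X (X ω'))
    change _ ≤ C * |X _ - X _| ^ s at this
    rw [e1, e2] at this
    rw [edist_dist, edist_dist, Real.dist_eq, Real.dist_eq, Real.coe_toNNReal _ hs.le,
      ENNReal.ofReal_rpow_of_nonneg (abs_nonneg _) hs.le]
    change _ ≤ ENNReal.ofReal C * _
    rw [← ENNReal.ofReal_mul hC0]
    exact ENNReal.ofReal_le_ofReal this
  have himg : Icc (0 : ℝ) 1 ⊆ f '' (range X) := by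
    intro y hy
    obtain ⟨ω, -, rfl⟩ := Real.ofDigits_SurjOn (b := 2) (by norm_num) hy
    refine ⟨X ω, ⟨ω, rfl⟩, ?_⟩
    have e1 : X (Function.invFun X (X ω)) = X ω := Function.invFun_eq ⟨ω, rfl⟩
    have := hb (Function.invFun X (X ω)) ω
    change _ ≤ C * |X _ - X _| ^ s at this
    rw [e1, sub_self, abs_zero, Real.zero_rpow hs.ne', mul_zero] at this
    have := abs_nonpos_iff.1 this
    change Real.ofDigits (Function.invFun X (X ω)) = _
    linarith
  have hd := (dimH_mono himg).trans (hf.dimH_image_le (Real.toNNReal_pos.2 hs))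
  rw [Real.dimH_of_nonempty_interior (by rw [interior_Icc]; exact nonempty_Ioo.2 one_pos)] at hd
  by_contra hc
  have hz : dimH (range X) = 0 := by simpa using hc
  rw [hz] at hd
  simp at hd

/-- For every integer `n ≥ 2`, there is a set `S ⊆ [0, 1/(β_n-1)]` of
strictly positive Hausdorff dimension such that every point of `S` has uncountably many
`β_n`-expansions, none of which is universal. -/
theorem exists_posDim_uncountable_expansions_no_universal (n : ℕ) (hn : 2 ≤ n) (β : ℝ)
    (hβ : IsNBonacci n β) :
    ∃ S : Set ℝ, S ⊆ Icc 0 (1 / (β - 1)) ∧ 0 < dimH S ∧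
      ∀ x ∈ S, ¬ ({a : ℕ → ℕ | IsBetaExpansion β x a}).Countable ∧
        ∀ a : ℕ → ℕ, ¬ IsUniversalExpansion β x a := by
  have h1 := hβ.1.1
  have hb0 : 0 < β := by linarith
  refine ⟨range (fun ω : ℕ → Fin 2 => tailVal β (bs n ω) 0), ?_, dim_pos hn hβ, ?_⟩
  · rintro _ ⟨ω, rfl⟩
    exact ⟨tail_nonneg h1 _ _, tail_le h1 (bs_le n ω) 0⟩
  · rintro _ ⟨ω, rfl⟩
    exact ⟨uncountable_exp hβ ω, not_universal hn hβ (bs_le n ω)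
      (c := 1 / β ^ (2 * (n + 2))) (by positivity) (bs_tail_ge hβ ω) (bs_tail_lt hn hβ ω)⟩
end
end
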